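/- For every ε > 0 there exists a positive integer n₀ such that every oriented graph G on n ≥ n₀ vertices satisfies (2/3)·t(G) + i(G) ≥ 1/10 − ε. -/

import Mathlib

open scoped Classical

/-- An oriented graph: a directed graph with no loops and no pair of
antiparallel edges, given by an asymmetric (hence irreflexive) adjacency
relation. -/
structure OrientedGraph (V : Type) [Fintype V] [DecidableEq V] where
  adj : V → V → Prop
  asymm : ∀ u v : V, adj u v → ¬ adj v u

namespace OrientedGraph

variable {V : Type} [Fintype V] [DecidableEq V]

/-- A 3-element vertex set spans a transitive triangle: its vertices are
pairwise adjacent and the induced orientation is acyclic. -/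
def isTransTriangle (G : OrientedGraph V) (s : Finset V) : Prop :=
  ∃ x y z : V, s = {x, y, z} ∧ G.adj x y ∧ G.adj y z ∧ G.adj x z

/-- A vertex set is independent: no two of its vertices are adjacent. -/
def isIndep (G : OrientedGraph V) (s : Finset V) : Prop :=
  ∀ x ∈ s, ∀ y ∈ s, ¬ G.adj x y

/-- `T₃(G)`: the number of 3-element vertex sets spanning a transitive triangle. -/
noncomputable def T3 (G : OrientedGraph V) : ℕ :=
  ((Finset.univ.powersetCard 3 : Finset (Finset V)).filter G.isTransTriangle).card

/-- `I₃(G)`: the number of 3-element vertex sets that are independent. -/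
noncomputable def I3 (G : OrientedGraph V) : ℕ :=
  ((Finset.univ.powersetCard 3 : Finset (Finset V)).filter G.isIndep).card

/-- `t(G) = T₃(G)/C(n,3)`. -/
noncomputable def tDens (G : OrientedGraph V) : ℝ :=
  (G.T3 : ℝ) / ((Fintype.card V).choose 3 : ℝ)

/-- `i(G) = I₃(G)/C(n,3)`. -/
noncomputable def iDens (G : OrientedGraph V) : ℝ :=
  (G.I3 : ℝ) / ((Fintype.card V).choose 3 : ℝ)

end OrientedGraph

open Finset

namespace OrientedGraph

variable {V : Type} [Fintype V] [DecidableEq V] (G : OrientedGraph V)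

/-- Indicator of an edge. -/
noncomputable def edgeInd (x y : V) : ℝ := if G.adj x y then 1 else 0

/-- Indicator that a triple of vertices spans a transitive triangle. -/
noncomputable def transInd (x y z : V) : ℝ := if G.isTransTriangle {x, y, z} then 1 else 0

/-- Indicator that a triple of (not necessarily distinct) vertices is independent. -/
noncomputable def indepInd (x y z : V) : ℝ := if G.isIndep {x, y, z} then 1 else 0

/-- The sum-of-squares kernel with apex `x`. -/
noncomputable def kernel (x y z : V) : ℝ :=
  5 / 2 * ((3 / 5 - G.edgeInd x y - G.edgeInd y x) * (3 / 5 - G.edgeInd x z - G.edgeInd z x))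
    + 1 / 2 * ((G.edgeInd x y - G.edgeInd y x) * (G.edgeInd x z - G.edgeInd z x))

lemma not_adj_self (x : V) : ¬ G.adj x x := fun h => G.asymm x x h h

lemma isTransTriangle_card {s : Finset V} (h : G.isTransTriangle s) : s.card = 3 := by
  obtain ⟨x, y, z, rfl, hxy, hyz, hxz⟩ := h
  refine card_eq_three.2 ⟨x, y, z, ?_, ?_, ?_, rfl⟩ <;> rintro rfl <;>
    exact G.not_adj_self _ (by assumption)

lemma isTransTriangle_of_adj {s : Finset V} {x y z : V} (hs : s = {x, y, z})
    (hxy : G.adj x y) (hyz : G.adj y z) (hxz : G.adj x z) : G.isTransTriangle s :=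
  ⟨x, y, z, hs, hxy, hyz, hxz⟩

lemma isIndep_triple_iff (x y z : V) : G.isIndep {x, y, z} ↔
    ¬ G.adj x y ∧ ¬ G.adj y x ∧ ¬ G.adj x z ∧ ¬ G.adj z x ∧ ¬ G.adj y z ∧ ¬ G.adj z y := by
  have hx := G.not_adj_self x
  have hy := G.not_adj_self y
  have hz := G.not_adj_self z
  simp only [isIndep, mem_insert, mem_singleton, forall_eq_or_imp, forall_eq]
  tauto

lemma transInd_nonneg (x y z : V) : 0 ≤ G.transInd x y z := by
  unfold transInd; split_ifs <;> norm_num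

lemma transInd_eq_one {x y z a b c : V} (hs : ({x, y, z} : Finset V) = {a, b, c})
    (hab : G.adj a b) (hbc : G.adj b c) (hac : G.adj a c) : G.transInd x y z = 1 :=
  if_pos (G.isTransTriangle_of_adj hs hab hbc hac)

/-- The pointwise inequality, averaging the kernel over the choice of the apex. -/
lemma kernel_average_le (x y z : V) :
    (G.kernel x y z + G.kernel y x z + G.kernel z x y) / 3 + 1 / 10
      ≤ 2 / 3 * G.transInd x y z + G.indepInd x y z := by
  have h0 := G.transInd_nonneg x y z
  have h1 : G.adj x y → G.adj y z → G.adj x z → G.transInd x y z = 1 :=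
    G.transInd_eq_one rfl
  have h2 : G.adj x z → G.adj z y → G.adj x y → G.transInd x y z = 1 :=
    G.transInd_eq_one (by grind)
  have h3 : G.adj y x → G.adj x z → G.adj y z → G.transInd x y z = 1 :=
    G.transInd_eq_one (by grind)
  have h4 : G.adj y z → G.adj z x → G.adj y x → G.transInd x y z = 1 :=
    G.transInd_eq_one (by grind)
  have h5 : G.adj z x → G.adj x y → G.adj z y → G.transInd x y z = 1 :=
    G.transInd_eq_one (by grind)
  have h6 : G.adj z y → G.adj y x → G.adj z x → G.transInd x y z = 1 :=
    G.transInd_eq_one (by grind)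
  have hxy := G.asymm x y
  have hxz := G.asymm x z
  have hyz := G.asymm y z
  simp only [kernel, indepInd, isIndep_triple_iff, edgeInd]
  generalize G.transInd x y z = t at *
  by_cases a1 : G.adj x y <;> by_cases a2 : G.adj y x <;> by_cases a3 : G.adj x z <;>
    by_cases a4 : G.adj z x <;> by_cases a5 : G.adj y z <;> by_cases a6 : G.adj z y <;>
    simp only [a1, a2, a3, a4, a5, a6, not_true_eq_false, not_false_eq_true, forall_const,
      if_true, if_false, and_self, and_true, and_false, IsEmpty.forall_iff]
      at * <;>
    linarith

lemma kernel_sum_nonneg : 0 ≤ ∑ x, ∑ y, ∑ z, G.kernel x y z := by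
  refine sum_nonneg fun x _ => ?_
  have h : ∑ y, ∑ z, G.kernel x y z =
      5 / 2 * (∑ y, (3 / 5 - G.edgeInd x y - G.edgeInd y x)) ^ 2
        + 1 / 2 * (∑ y, (G.edgeInd x y - G.edgeInd y x)) ^ 2 := by
    simp only [kernel, sum_add_distrib, sq, sum_mul_sum, ← mul_sum]
  rw [h]
  positivity

lemma card_cube_le_sum :
    (Fintype.card V : ℝ) ^ 3 / 10
      ≤ 2 / 3 * ∑ x, ∑ y, ∑ z, G.transInd x y z + ∑ x, ∑ y, ∑ z, G.indepInd x y z := by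
  have h := sum_le_sum fun x (_ : x ∈ (univ : Finset V)) =>
    sum_le_sum fun y (_ : y ∈ (univ : Finset V)) =>
      sum_le_sum fun z (_ : z ∈ (univ : Finset V)) => G.kernel_average_le x y z
  simp only [sum_add_distrib, ← sum_div, ← mul_sum, sum_const, card_univ, nsmul_eq_mul] at h
  have e1 : ∑ x, ∑ y, ∑ z, G.kernel y x z = ∑ x, ∑ y, ∑ z, G.kernel x y z := sum_comm
  have e2 : ∑ x, ∑ y, ∑ z, G.kernel z x y = ∑ x, ∑ y, ∑ z, G.kernel x y z :=
    (sum_congr rfl fun _ _ => sum_comm).trans sum_comm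
  have h0 := G.kernel_sum_nonneg
  rw [e1, e2] at h
  nlinarith

/-- Every family of 3-sets is hit by at most six ordered triples per member. -/
lemma card_triples_le (P : Finset V → Prop) :
    ((univ : Finset (V × V × V)).filter fun p =>
      ({p.1, p.2.1, p.2.2} : Finset V).card = 3 ∧ P {p.1, p.2.1, p.2.2}).card
      ≤ 6 * ((univ.powersetCard 3 : Finset (Finset V)).filter P).card := by
  refine card_le_mul_card_image_of_maps_to
    (f := fun p : V × V × V => ({p.1, p.2.1, p.2.2} : Finset V)) ?_ 6 ?_
  · intro p hp
    simpa [mem_powersetCard] using hp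
  · intro s hs
    obtain ⟨a, b, c, hab, hac, hbc, rfl⟩ :=
      card_eq_three.1 (mem_powersetCard.1 (mem_filter.1 hs).1).2
    refine (card_le_card (t := {(a, b, c), (a, c, b), (b, a, c), (b, c, a), (c, a, b), (c, b, a)})
      ?_).trans card_le_six
    rintro ⟨x, y, z⟩ hp
    simp only [mem_filter, mem_univ, true_and] at hp
    obtain ⟨⟨h3, -⟩, he⟩ := hp
    have hx : x ∈ ({a, b, c} : Finset V) := by simp [← he]
    have hy : y ∈ ({a, b, c} : Finset V) := by simp [← he]
    have hz : z ∈ ({a, b, c} : Finset V) := by simp [← he]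
    have hxy : x ≠ y := by
      rintro rfl
      have := card_le_two (a := x) (b := z)
      simp only [insert_eq_of_mem, mem_insert_self] at h3
      omega
    have hxz : x ≠ z := by
      rintro rfl
      have := card_le_two (a := y) (b := x)
      rw [insert_eq_of_mem (by simp)] at h3
      omega
    have hyz : y ≠ z := by
      rintro rfl
      have := card_le_two (a := x) (b := y)
      simp only [pair_eq_singleton] at h3
      omega
    simp only [mem_insert, mem_singleton, Prod.mk.injEq] at hx hy hz ⊢
    grind

lemma sum_transInd_le : ∑ x, ∑ y, ∑ z, G.transInd x y z ≤ 6 * (G.T3 : ℝ) := by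
  have h := card_triples_le G.isTransTriangle
  have e : ∑ x, ∑ y, ∑ z, G.transInd x y z =
      (((univ : Finset (V × V × V)).filter fun p =>
        ({p.1, p.2.1, p.2.2} : Finset V).card = 3 ∧
          G.isTransTriangle {p.1, p.2.1, p.2.2}).card : ℝ) := by
    simp only [card_filter, Nat.cast_sum, Fintype.sum_prod_type, Nat.cast_ite, Nat.cast_one,
      Nat.cast_zero, transInd,
      and_iff_right_of_imp (fun h : G.isTransTriangle _ => G.isTransTriangle_card h)]
  rw [e]
  exact_mod_cast h

lemma sum_indepInd_le :
    ∑ x, ∑ y, ∑ z, G.indepInd x y z ≤ 6 * (G.I3 : ℝ) + 3 * (Fintype.card V : ℝ) ^ 2 := by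
  have h := card_triples_le G.isIndep
  have hp : ∀ x y z, G.indepInd x y z ≤
      (if ({x, y, z} : Finset V).card = 3 ∧ G.isIndep {x, y, z} then 1 else 0)
        + ((if x = y then 1 else 0) + (if x = z then 1 else 0) + (if y = z then 1 else 0)) := by
    intro x y z
    have h3 : x ≠ y → x ≠ z → y ≠ z → ({x, y, z} : Finset V).card = 3 :=
      fun a b c => card_eq_three.2 ⟨x, y, z, a, b, c, rfl⟩
    unfold indepInd
    split_ifs <;> first | (exfalso; tauto) | norm_num
  have hs := sum_le_sum fun x (_ : x ∈ (univ : Finset V)) =>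
    sum_le_sum fun y (_ : y ∈ (univ : Finset V)) =>
      sum_le_sum fun z (_ : z ∈ (univ : Finset V)) => hp x y z
  have e : ∑ x, ∑ y, ∑ z,
      (if ({x, y, z} : Finset V).card = 3 ∧ G.isIndep {x, y, z} then (1 : ℝ) else 0) =
      (((univ : Finset (V × V × V)).filter fun p =>
        ({p.1, p.2.1, p.2.2} : Finset V).card = 3 ∧
          G.isIndep {p.1, p.2.1, p.2.2}).card : ℝ) := by
    simp only [card_filter, Nat.cast_sum, Fintype.sum_prod_type, Nat.cast_ite, Nat.cast_one,
      Nat.cast_zero]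
  have h' : (((univ : Finset (V × V × V)).filter fun p =>
        ({p.1, p.2.1, p.2.2} : Finset V).card = 3 ∧
          G.isIndep {p.1, p.2.1, p.2.2}).card : ℝ) ≤ 6 * (G.I3 : ℝ) := by exact_mod_cast h
  simp only [sum_add_distrib] at hs
  rw [e] at hs
  simp only [sum_ite_eq, mem_univ, if_true, sum_const, card_univ, nsmul_eq_mul, mul_ite,
    mul_one, mul_zero] at hs
  nlinarith

end OrientedGraph

/-- For every ε > 0 there exists n₀ such that every oriented graph `G` on
`n ≥ n₀` vertices satisfies `(2/3)·t(G) + i(G) ≥ 1/10 − ε`. -/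
theorem stmt_8 (ε : ℝ) (hε : 0 < ε) :
    ∃ n₀ : ℕ, 0 < n₀ ∧ ∀ n : ℕ, n₀ ≤ n → ∀ G : OrientedGraph (Fin n),
      1 / 10 - ε ≤ (2 / 3) * G.tDens + G.iDens := by
  refine ⟨max 4 ⌈8 / ε⌉₊, by positivity, fun n hn G => ?_⟩
  have hn4 : (4 : ℝ) ≤ n := by exact_mod_cast (le_max_left _ _).trans hn
  have hne : 8 / ε ≤ n := (Nat.le_ceil _).trans (by exact_mod_cast (le_max_right _ _).trans hn)
  rw [div_le_iff₀ hε] at hne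
  have h1 := G.card_cube_le_sum
  have h2 := G.sum_transInd_le
  have h3 := G.sum_indepInd_le
  unfold OrientedGraph.tDens OrientedGraph.iDens
  simp only [Fintype.card_fin] at h1 h2 h3 ⊢
  have hc : ((n.choose 3 : ℕ) : ℝ) = n * (n - 1) * (n - 2) / 6 := by
    rw [Nat.cast_choose_eq_descPochhammer_div]
    norm_num [descPochhammer_succ_right, Nat.factorial]
  have hpos : (0 : ℝ) < n * (n - 1) * (n - 2) / 6 := by
    have : (0 : ℝ) < n - 1 := by linarith
    have : (0 : ℝ) < n - 2 := by linarith
    positivity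
  have hm : (n : ℝ) ^ 2 * 3 / 8 ≤ (n - 1) * (n - 2) := by nlinarith
  have hm' : 3 * (n : ℝ) ^ 2 ≤ ε * (n * (n - 1) * (n - 2)) := by
    have := mul_le_mul_of_nonneg_left hm (by positivity : 0 ≤ n * ε)
    nlinarith [mul_le_mul_of_nonneg_right hne (sq_nonneg (n : ℝ))]
  have hcube : (n : ℝ) * (n - 1) * (n - 2) ≤ n ^ 3 := by nlinarith
  rw [hc, ← mul_div_assoc, ← add_div, le_div_iff₀ hpos]
  linarith
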